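/- (Theorem 3: device-independent certification of the N-partite GHZ state with dishonest parties) Let N ≥ 2, 2 ≤ k ≤ N. Let A_0^{(i)}, A_1^{(i)} be binary observables on ℂ^{d_i} for i = 1,…,k−1, let M_v be a binary observable on ℂ^{d_D} for each v ∈ {0,1}^{N−k+1}, and let ψ be a unit vector in ℂ^{d_1}⊗…⊗ℂ^{d_{k−1}}⊗ℂ^{d_D} with ⟨ψ, Ŝ_N^+ ψ⟩ = 2^{N−1}√2, where Ŝ_N^+ = Σ_{x ∈ {0,1}^N} (−1)^{w(x)(w(x)+1)/2} A_{x_1}^{(1)}⊗…⊗A_{x_{k−1}}^{(k−1)}⊗M_{(x_k,…,x_N)}. Then there exist natural numbers m_1,…,m_{k−1}, m_D, linear isometries V_i : ℂ^{d_i} → ℂ² ⊗ ℂ^{m_i} for i = 1,…,k−1, a linear isometry V_D : ℂ^{d_D} → (ℂ²)^{⊗(N−k+1)} ⊗ ℂ^{m_D}, and a unit vector ζ ∈ ℂ^{m_1}⊗…⊗ℂ^{m_{k−1}}⊗ℂ^{m_D} such that, under the canonical reordering of tensor factors, (V_1 ⊗ … ⊗ V_{k−1} ⊗ V_D) ψ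 = Φ^N ⊗ ζ, where Φ^N = (|0⟩^{⊗N} + |1⟩^{⊗N})/√2 is the N-partite GHZ state. -/

import Mathlib

open Matrix

noncomputable section

/-- Hamming weight of a bit string. -/
def wt {n : ℕ} (x : Fin n → Fin 2) : ℕ := ∑ i, (x i : ℕ)

/-- The Svetlichny sign `(-1)^{w(x)(w(x)+1)/2}`. -/
def sgn {n : ℕ} (x : Fin n → Fin 2) : ℂ := (-1) ^ (wt x * (wt x + 1) / 2)

/-- The joint Hilbert-space index of `h` honest parties (local dimensions `d i`) and the
grouped dishonest parties (dimension `dD`). -/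
abbrev FullIdx (h : ℕ) (d : Fin h → ℕ) (dD : ℕ) :=
  ((i : Fin h) → Fin (d i)) × Fin dD

/-- The tensor-product observable
`A^{(1)}_{x_1} ⊗ ⋯ ⊗ A^{(k-1)}_{x_{k-1}} ⊗ M_{(x_k,…,x_N)}`, written entrywise; here
`h = k - 1` and the dishonest input strings have length `N - k + 1 = s + 1`. -/
def bigOp {h s : ℕ} {d : Fin h → ℕ} {dD : ℕ}
    (A : (i : Fin h) → Fin 2 → Matrix (Fin (d i)) (Fin (d i)) ℂ)
    (M : (Fin (s + 1) → Fin 2) → Matrix (Fin dD) (Fin dD) ℂ)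
    (x : Fin (h + (s + 1)) → Fin 2) :
    Matrix (FullIdx h d dD) (FullIdx h d dD) ℂ :=
  Matrix.of fun p q =>
    (∏ i, A i (x (Fin.castAdd (s + 1) i)) (p.1 i) (q.1 i)) *
      M (fun j => x (Fin.natAdd h j)) p.2 q.2

/-- The Svetlichny–Bell operator `Ŝ_N^+` with a grouped dishonest set (`N = h + (s+1)`). -/
def svetOp {h s : ℕ} {d : Fin h → ℕ} {dD : ℕ}
    (A : (i : Fin h) → Fin 2 → Matrix (Fin (d i)) (Fin (d i)) ℂ)
    (M : (Fin (s + 1) → Fin 2) → Matrix (Fin dD) (Fin dD) ℂ) :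
    Matrix (FullIdx h d dD) (FullIdx h d dD) ℂ :=
  ∑ x : Fin (h + (s + 1)) → Fin 2, sgn x • bigOp A M x

/-- The GHZ state `(|0…0⟩ + |1…1⟩)/√2` on the qubits indexed by `α`. -/
def ghzVec {α : Type*} [Fintype α] [DecidableEq α] : (α → Fin 2) → ℂ :=
  fun b => ((if b = fun _ => 0 then 1 else 0) + (if b = fun _ => 1 then 1 else 0)) /
    (Real.sqrt 2 : ℂ)

/-- `√2` as a complex number. -/
def rootTwo : ℂ := (Real.sqrt 2 : ℂ)

lemma rootTwo_mul_self : rootTwo * rootTwo = 2 := by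
  unfold rootTwo
  rw [← Complex.ofReal_mul, Real.mul_self_sqrt (by norm_num)]
  norm_num

lemma rootTwo_ne_zero : rootTwo ≠ 0 := by
  intro h
  have := rootTwo_mul_self
  simp [h] at this

lemma star_rootTwo : star rootTwo = rootTwo := Complex.conj_ofReal _

section Algebra

variable {R : Type*} [Ring R] [Algebra ℂ R]

/-- The two blocks of the qubit-extraction isometry built from a pair of involutions `X`, `Y`,
with a relative phase `τ` on the second block. -/
def swapBlock (X Y : R) (τ : ℂ) (b : Fin 2) : R :=
  if b = 0 then (rootTwo / 4) • ((1 + X) - Complex.I • (Y * (1 - X)))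
  else (τ * (rootTwo / 4)) • ((1 + X) + Complex.I • (Y * (1 - X)))

lemma map_swapBlock {S : Type*} [Ring S] [Algebra ℂ S] (φ : R →ₐ[ℂ] S) (X Y : R) (τ : ℂ)
    (b : Fin 2) : φ (swapBlock X Y τ b) = swapBlock (φ X) (φ Y) τ b := by
  unfold swapBlock
  split_ifs <;> simp

lemma swapBlock_add (X Y : R) :
    swapBlock X Y 1 0 + swapBlock X Y 1 1 = (rootTwo / 2) • (1 + X) := by
  simp only [swapBlock, if_true, Fin.isValue, one_ne_zero, if_false]
  module

lemma commute_swapBlock {X Y Z : R} (hX : Commute Z X) (hY : Commute Z Y) (τ : ℂ) (b : Fin 2) :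
    Commute Z (swapBlock X Y τ b) := by
  have h : Commute Z (Complex.I • (Y * (1 - X))) :=
    (hY.mul_right ((Commute.one_right _).sub_right hX)).smul_right _
  unfold swapBlock
  split_ifs
  · exact (((Commute.one_right _).add_right hX).sub_right h).smul_right _
  · exact (((Commute.one_right _).add_right hX).add_right h).smul_right _

lemma anticommute_of_mul_eq {A₀ A₁ G Ψ : R} (hA₀ : A₀ * A₀ = 1) (hA₁ : A₁ * A₁ = 1)
    (hG : G * G = 1) (hc₀ : G * A₀ = A₀ * G) (hc₁ : G * A₁ = A₁ * G)
    (h : rootTwo • (G * Ψ) = (A₀ - A₁) * Ψ) : A₀ * (A₁ * Ψ) = -(A₁ * (A₀ * Ψ)) := by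
  have h1 : rootTwo • (G * (G * Ψ)) = (A₀ - A₁) * (G * Ψ) := by
    rw [← mul_smul_comm, h, ← mul_assoc, ← mul_assoc, mul_sub, hc₀, hc₁]
    simp only [sub_mul]
  have h2 : (2 : ℂ) • Ψ = (A₀ - A₁) * ((A₀ - A₁) * Ψ) := by
    rw [← h, mul_smul_comm, ← h1, ← mul_assoc, hG, one_mul, smul_smul, rootTwo_mul_self]
  have e0 : A₀ * (A₀ * Ψ) = Ψ := by rw [← mul_assoc, hA₀, one_mul]
  have e1 : A₁ * (A₁ * Ψ) = Ψ := by rw [← mul_assoc, hA₁, one_mul]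
  simp only [sub_mul, mul_sub, e0, e1] at h2
  linear_combination (norm := module) h2

/-- The product of the two observables `G₁ G₀` acts on the state as `A₁ A₀` does. -/
lemma mul_eq_of_mul_eq {A₀ A₁ G₀ G₁ Ψ : R} (hA₀ : A₀ * A₀ = 1) (hA₁ : A₁ * A₁ = 1)
    (hc₀ : G₁ * A₀ = A₀ * G₁) (hc₁ : G₁ * A₁ = A₁ * G₁)
    (hac : A₀ * (A₁ * Ψ) = -(A₁ * (A₀ * Ψ)))
    (h₀ : rootTwo • (G₀ * Ψ) = (A₀ - A₁) * Ψ) (h₁ : rootTwo • (G₁ * Ψ) = -((A₀ + A₁) * Ψ)) :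
    G₁ * (G₀ * Ψ) = A₁ * (A₀ * Ψ) := by
  have e0 : A₀ * (A₀ * Ψ) = Ψ := by rw [← mul_assoc, hA₀, one_mul]
  have e1 : A₁ * (A₁ * Ψ) = Ψ := by rw [← mul_assoc, hA₁, one_mul]
  have h2 : (2 : ℂ) • (G₁ * (G₀ * Ψ)) = (2 : ℂ) • (A₁ * (A₀ * Ψ)) := by
    calc (2 : ℂ) • (G₁ * (G₀ * Ψ)) = rootTwo • (G₁ * (rootTwo • (G₀ * Ψ))) := by
          rw [mul_smul_comm, smul_smul, rootTwo_mul_self]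
      _ = (A₀ - A₁) * (rootTwo • (G₁ * Ψ)) := by
          rw [h₀, ← mul_assoc, mul_sub, hc₀, hc₁, ← sub_mul, mul_assoc, mul_smul_comm]
      _ = (2 : ℂ) • (A₁ * (A₀ * Ψ)) := by
          rw [h₁]
          simp only [mul_neg, add_mul, sub_mul, mul_add, e0, e1, hac]
          module
  exact smul_right_injective R (two_ne_zero (α := ℂ)) h2

lemma mul_eq_neg_of_mul_eq {A₀ A₁ G₀ G₁ Ψ : R} (hA₀ : A₀ * A₀ = 1) (hA₁ : A₁ * A₁ = 1)
    (hc₀ : G₀ * A₀ = A₀ * G₀) (hc₁ : G₀ * A₁ = A₁ * G₀)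
    (hac : A₀ * (A₁ * Ψ) = -(A₁ * (A₀ * Ψ)))
    (h₀ : rootTwo • (G₀ * Ψ) = (A₀ - A₁) * Ψ) (h₁ : rootTwo • (G₁ * Ψ) = -((A₀ + A₁) * Ψ)) :
    G₀ * (G₁ * Ψ) = -(A₁ * (A₀ * Ψ)) := by
  have e0 : A₀ * (A₀ * Ψ) = Ψ := by rw [← mul_assoc, hA₀, one_mul]
  have e1 : A₁ * (A₁ * Ψ) = Ψ := by rw [← mul_assoc, hA₁, one_mul]
  have h2 : (2 : ℂ) • (G₀ * (G₁ * Ψ)) = (2 : ℂ) • -(A₁ * (A₀ * Ψ)) := by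
    calc (2 : ℂ) • (G₀ * (G₁ * Ψ)) = rootTwo • (G₀ * (rootTwo • (G₁ * Ψ))) := by
          rw [mul_smul_comm, smul_smul, rootTwo_mul_self]
      _ = -((A₀ + A₁) * (rootTwo • (G₀ * Ψ))) := by
          rw [h₁, mul_neg, ← mul_assoc, mul_add, hc₀, hc₁, ← add_mul, mul_assoc, mul_smul_comm,
            smul_neg]
      _ = (2 : ℂ) • -(A₁ * (A₀ * Ψ)) := by
          rw [h₀]
          simp only [add_mul, sub_mul, mul_sub, e0, e1, hac]
          module
  exact smul_right_injective R (two_ne_zero (α := ℂ)) h2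

/-- On a state where `X` and `Y` anticommute, the extraction block is a projected phase shift. -/
lemma swapBlock_mul {X Y Ψ : R} (τ : ℂ) (hX : X * X = 1)
    (hac : X * (Y * Ψ) = -(Y * (X * Ψ))) (b : Fin 2) :
    ∃ c : ℂ, swapBlock X Y τ b * Ψ =
      c • ((1 + X) * (Ψ + ((-1) ^ (b : ℕ) * Complex.I) • (Y * (X * Ψ)))) := by
  have e : X * (Y * (X * Ψ)) = -(Y * Ψ) := by
    have := congrArg (X * ·) hac
    simp only [mul_neg, ← mul_assoc, hX, one_mul] at this
    rw [this, neg_neg]; simp only [mul_assoc]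
  fin_cases b
  · refine ⟨rootTwo / 4, ?_⟩
    simp only [swapBlock, Fin.zero_eta, if_true, smul_mul_assoc, add_mul, sub_mul, one_mul,
      mul_sub, mul_one, mul_add, mul_smul_comm, mul_assoc, e]
    simp
    module
  · refine ⟨τ * (rootTwo / 4), ?_⟩
    simp only [swapBlock, Fin.mk_one, one_ne_zero, Fin.isValue, if_false, smul_mul_assoc, add_mul,
      sub_mul, one_mul, mul_sub, mul_one, mul_add, mul_smul_comm, mul_assoc, e]
    simp
    module

lemma swapBlock_mul_swapBlock_eq_zero {A₀ A₁ D₀ D₁ Ψ : R} (σ τ : ℂ)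
    (hA₀ : A₀ * A₀ = 1) (hA₁ : A₁ * A₁ = 1) (hD₀ : D₀ * D₀ = 1)
    (h₀₀ : Commute D₀ A₀) (h₀₁ : Commute D₀ A₁) (h₁₀ : Commute D₁ A₀) (h₁₁ : Commute D₁ A₁)
    (hA : A₀ * (A₁ * Ψ) = -(A₁ * (A₀ * Ψ))) (hD : D₀ * (D₁ * Ψ) = -(D₁ * (D₀ * Ψ)))
    (hDA : D₁ * (D₀ * Ψ) = A₁ * (A₀ * Ψ)) {b c : Fin 2} (hbc : b ≠ c) :
    swapBlock A₀ A₁ σ b * (swapBlock D₀ D₁ τ c * Ψ) = 0 := by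
  obtain ⟨u, hu⟩ := swapBlock_mul τ hD₀ hD c
  obtain ⟨v, hv⟩ := swapBlock_mul σ hA₀ hA b
  set J := A₁ * A₀ with hJ
  have hJD₀ : Commute D₀ J := h₀₁.mul_right h₀₀
  have hJD₁ : Commute D₁ J := h₁₁.mul_right h₁₀
  have hJJ : J * (J * Ψ) = -Ψ := by
    simp only [hJ, mul_assoc]
    have : A₀ * (A₁ * (A₀ * Ψ)) = -(A₁ * Ψ) := by
      rw [← neg_eq_iff_eq_neg.mpr hA, mul_neg, ← mul_assoc, hA₀, one_mul]
    rw [this, mul_neg, ← mul_assoc, hA₁, one_mul]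
  have hsb : Commute (swapBlock A₀ A₁ σ b) (1 + D₀) :=
    (commute_swapBlock ((Commute.one_left _).add_left h₀₀) ((Commute.one_left _).add_left h₀₁)
      σ b).symm
  have hsJ : swapBlock A₀ A₁ σ b * (D₁ * (D₀ * Ψ)) =
      v • ((1 + A₀) * (J * Ψ + ((-1) ^ (b : ℕ) * Complex.I) • (J * (J * Ψ)))) := by
    have hcomm : Commute (swapBlock A₀ A₁ σ b) (D₁ * D₀) :=
      (commute_swapBlock (h₁₀.mul_left h₀₀) (h₁₁.mul_left h₀₁) σ b).symm
    have h1 : Commute (D₁ * D₀) (1 + A₀) := (Commute.one_right _).add_right (h₁₀.mul_left h₀₀)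
    have hDD : D₁ * D₀ * Ψ = J * Ψ := by rw [mul_assoc, hDA, hJ, mul_assoc]
    have h3 : Commute (D₁ * D₀) J := hJD₁.mul_left hJD₀
    rw [← mul_assoc D₁, ← mul_assoc, hcomm.eq, mul_assoc, hv, mul_smul_comm, ← mul_assoc,
      h1.eq, mul_assoc, mul_add, hDD, mul_smul_comm, ← mul_assoc A₁, ← hJ, ← mul_assoc _ J Ψ,
      h3.eq, mul_assoc J, hDD]
  rw [hu, mul_smul_comm, ← mul_assoc, hsb.eq, mul_assoc, mul_add, mul_smul_comm, hsJ, hv, hJJ,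
    ← mul_assoc A₁, ← hJ]
  have key : (Ψ + ((-1) ^ (b : ℕ) * Complex.I) • (J * Ψ)) + ((-1) ^ (c : ℕ) * Complex.I) •
      (J * Ψ + ((-1) ^ (b : ℕ) * Complex.I) • -Ψ) = 0 := by
    have hs : ((-1 : ℂ) ^ (c : ℕ)) = -(-1) ^ (b : ℕ) := by
      fin_cases b <;> fin_cases c <;> simp at hbc ⊢
    have hb : ((-1 : ℂ) ^ (b : ℕ)) * (-1) ^ (b : ℕ) = 1 := by
      fin_cases b <;> simp
    rw [hs]
    match_scalars
    · linear_combination Complex.I * Complex.I * hb + Complex.I_mul_I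
    · ring
  rw [smul_comm _ v, ← smul_add, ← mul_smul_comm _ (1 + A₀),
    ← mul_add (1 + A₀), key]
  simp

/-- The relative phase `e^{iπ/4}` between the two branches of the extracted GHZ state. -/
def ghzPhase : ℂ := (1 + Complex.I) * (rootTwo / 2)

lemma swapBlock_ghzPhase {D₀ D₁ Φ : R} (hD₀ : D₀ * D₀ = 1)
    (hD : D₀ * (D₁ * Φ) = -(D₁ * (D₀ * Φ))) (hΦ : rootTwo • Φ = (D₀ - D₁) * Φ) :
    swapBlock D₀ D₁ ghzPhase 1 * Φ = swapBlock D₀ D₁ ghzPhase 0 * Φ := by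
  have hD₁ : D₁ * Φ = D₀ * Φ - rootTwo • Φ := by rw [hΦ]; noncomm_ring
  have e0 : D₀ * (D₀ * Φ) = Φ := by rw [← mul_assoc, hD₀, one_mul]
  have e1 : D₁ * (D₀ * Φ) = rootTwo • (D₀ * Φ) - Φ := by
    rw [← neg_eq_iff_eq_neg.mpr hD, hD₁, mul_sub, e0, mul_smul_comm]; abel
  simp only [swapBlock, if_true, Fin.isValue, one_ne_zero, if_false, smul_mul_assoc, add_mul,
    sub_mul, mul_sub, mul_one, one_mul, mul_assoc, e1, hD₁, ghzPhase]
  have hr := rootTwo_mul_self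
  have hI := Complex.I_mul_I
  match_scalars
  · linear_combination (rootTwo / 8 - rootTwo * Complex.I / 8) * hr +
      (rootTwo ^ 2 / 8 - rootTwo ^ 3 / 8) * hI
  · linear_combination (rootTwo / 8 - rootTwo * Complex.I / 8) * hr +
      (rootTwo ^ 2 / 8 - rootTwo ^ 3 / 8) * hI

end Algebra

section Tensor

variable {ι : Type*} [Fintype ι] {n : ι → Type*} {m : Type*}

/-- The tensor product of a family of square matrices and one further square matrix. -/
def tens (L : ∀ i, Matrix (n i) (n i) ℂ) (K : Matrix m m ℂ) :
    Matrix ((∀ i, n i) × m) ((∀ i, n i) × m) ℂ :=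
  Matrix.of fun p q => (∏ i, L i (p.1 i) (q.1 i)) * K p.2 q.2

lemma conjTranspose_tens (L : ∀ i, Matrix (n i) (n i) ℂ) (K : Matrix m m ℂ) :
    (tens L K)ᴴ = tens (fun i => (L i)ᴴ) Kᴴ := by
  ext p q
  simp [tens, Matrix.conjTranspose_apply, mul_comm]

section

variable [∀ i, DecidableEq (n i)] [DecidableEq m]

lemma tens_one : tens (fun i => (1 : Matrix (n i) (n i) ℂ)) (1 : Matrix m m ℂ) = 1 := by
  ext p q
  simp only [tens, Matrix.of_apply, Matrix.one_apply, Finset.prod_ite_zero, Prod.ext_iff,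
    funext_iff, ite_and]
  by_cases h : ∀ i, p.1 i = q.1 i <;> by_cases h' : p.2 = q.2 <;> simp [h, h']

end

variable [DecidableEq ι]

lemma sum_tens {β : Type*} [Fintype β] [DecidableEq β] (L : ∀ i, β → Matrix (n i) (n i) ℂ)
    (K : β → Matrix m m ℂ) :
    ∑ b : ι → β, ∑ c, tens (fun i => L i (b i)) (K c) = tens (fun i => ∑ b, L i b) (∑ c, K c) := by
  ext p q
  simp only [tens, Matrix.sum_apply, Matrix.of_apply, Finset.prod_univ_sum,
    Fintype.piFinset_univ, Finset.sum_mul_sum]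

lemma tens_update_apply (L : ∀ i, Matrix (n i) (n i) ℂ) (K : Matrix m m ℂ) (i : ι)
    (X : Matrix (n i) (n i) ℂ) (p q : (∀ i, n i) × m) :
    tens (Function.update L i X) K p q =
      X (p.1 i) (q.1 i) * ((∏ j ∈ {i}ᶜ, L j (p.1 j) (q.1 j)) * K p.2 q.2) := by
  simp only [tens, Matrix.of_apply]
  rw [Fintype.prod_eq_mul_prod_compl i, Function.update_self, mul_assoc]
  congr 2
  refine Finset.prod_congr rfl fun j hj => ?_
  rw [Function.update_of_ne (by simpa using hj)]

variable [∀ i, Fintype (n i)] [Fintype m]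

lemma tens_mul_tens (L L' : ∀ i, Matrix (n i) (n i) ℂ) (K K' : Matrix m m ℂ) :
    tens L K * tens L' K' = tens (fun i => L i * L' i) (K * K') := by
  ext p q
  simp only [tens, Matrix.mul_apply, Matrix.of_apply, Fintype.sum_prod_type,
    Finset.prod_univ_sum, Fintype.piFinset_univ, Finset.sum_mul_sum, Finset.prod_mul_distrib]
  exact Finset.sum_congr rfl fun _ _ => Finset.sum_congr rfl fun _ _ => by ring

variable [∀ i, DecidableEq (n i)] [DecidableEq m]

/-- The embedding of the operators on the factor `i`. -/
def factorHom (i : ι) :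
    Matrix (n i) (n i) ℂ →ₐ[ℂ] Matrix ((∀ i, n i) × m) ((∀ i, n i) × m) ℂ :=
  AlgHom.ofLinearMap
    { toFun := fun X => tens (Function.update (fun _ => 1) i X) 1
      map_add' := fun X Y => by
        ext p q
        simp only [Matrix.add_apply, tens_update_apply, add_mul]
      map_smul' := fun c X => by
        ext p q
        simp only [Matrix.smul_apply, tens_update_apply, smul_eq_mul, mul_assoc, RingHom.id_apply] }
    (by simp only [LinearMap.coe_mk, AddHom.coe_mk]
        rw [Function.update_eq_self i (fun i => (1 : Matrix (n i) (n i) ℂ)), tens_one])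
    (fun X Y => by
      simp only [LinearMap.coe_mk, AddHom.coe_mk, tens_mul_tens, mul_one]
      congr 1
      ext1 j
      by_cases h : j = i
      · subst h; simp
      · simp [Function.update_of_ne h])

lemma factorHom_apply (i : ι) (X : Matrix (n i) (n i) ℂ) :
    factorHom (m := m) i X = tens (Function.update (fun _ => 1) i X) 1 := rfl

/-- The embedding of the operators on the last factor. -/
def lastHom : Matrix m m ℂ →ₐ[ℂ] Matrix ((∀ i, n i) × m) ((∀ i, n i) × m) ℂ :=
  AlgHom.ofLinearMap
    { toFun := fun X => tens (fun _ => 1) X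
      map_add' := fun X Y => by
        ext p q
        simp only [Matrix.add_apply, tens, Matrix.of_apply, mul_add]
      map_smul' := fun c X => by
        ext p q
        simp only [Matrix.smul_apply, tens, Matrix.of_apply, smul_eq_mul, RingHom.id_apply]
        ring }
    tens_one
    (fun X Y => by simp only [LinearMap.coe_mk, AddHom.coe_mk, tens_mul_tens, mul_one])

lemma lastHom_apply (X : Matrix m m ℂ) :
    lastHom (n := n) X = tens (fun _ => 1) X := rfl

lemma commute_tens_lastHom (L : ∀ i, Matrix (n i) (n i) ℂ) (X : Matrix m m ℂ) :
    Commute (tens L 1) (lastHom X) := by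
  simp [Commute, SemiconjBy, lastHom_apply, tens_mul_tens]

lemma tens_eq_mul_lastHom (L : ∀ i, Matrix (n i) (n i) ℂ) (X : Matrix m m ℂ) :
    tens L X = tens L 1 * lastHom X := by
  simp [lastHom_apply, tens_mul_tens]

lemma commute_lastHom_factorHom (i : ι) (X : Matrix m m ℂ) (Y : Matrix (n i) (n i) ℂ) :
    Commute (lastHom X) (factorHom i Y) :=
  (commute_tens_lastHom _ _).symm

lemma tens_update_one_mul_factorHom (L : ∀ i, Matrix (n i) (n i) ℂ) (K : Matrix m m ℂ) (i : ι) :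
    tens (Function.update L i 1) K * factorHom i (L i) = tens L K := by
  rw [factorHom_apply, tens_mul_tens, mul_one]
  congr 1
  ext1 j
  by_cases h : j = i
  · subst h; simp
  · simp [Function.update_of_ne h]

lemma commute_tens_factorHom {L : ∀ i, Matrix (n i) (n i) ℂ} (K : Matrix m m ℂ) {i : ι}
    {Y : Matrix (n i) (n i) ℂ} (h : Commute (L i) Y) :
    Commute (tens L K) (factorHom i Y) := by
  rw [Commute, SemiconjBy, factorHom_apply, tens_mul_tens, tens_mul_tens, mul_one, one_mul]
  congr 1
  ext1 j
  by_cases h' : j = i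
  · subst h'; simpa using h.eq
  · simp [Function.update_of_ne h']

/-- Operators on the factors may be replaced by operators that act equally on a state. -/
lemma tens_mul_congr {L L' : ∀ i, Matrix (n i) (n i) ℂ}
    {Ψ : Matrix ((∀ i, n i) × m) ((∀ i, n i) × m) ℂ}
    (h : ∀ i, factorHom i (L i) * Ψ = factorHom i (L' i) * Ψ) :
    tens L 1 * Ψ = tens L' 1 * Ψ := by
  have key : ∀ s : Finset ι, tens (s.piecewise L fun _ => 1) 1 * Ψ =
      tens (s.piecewise L' fun _ => 1) 1 * Ψ := by
    intro s
    induction s using Finset.induction_on with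
    | empty => simp
    | insert a s ha ih =>
      have e : ∀ F : ∀ i, Matrix (n i) (n i) ℂ,
          tens (n := n) (m := m) ((insert a s).piecewise F fun _ => 1) 1 =
            tens (s.piecewise F fun _ => 1) 1 * factorHom a (F a) := by
        intro F
        rw [factorHom_apply, tens_mul_tens, mul_one]
        congr 1
        ext1 j
        by_cases h' : j = a
        · subst h'; simp [ha]
        · simp [h', Finset.piecewise]
      have c : Commute (tens (s.piecewise L fun _ => 1) 1) (factorHom (m := m) a (L' a)) :=
        commute_tens_factorHom 1 (by simp [ha])
      have c' : Commute (tens (s.piecewise L' fun _ => 1) 1) (factorHom (m := m) a (L' a)) :=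
        commute_tens_factorHom 1 (by simp [ha])
      rw [e, e, mul_assoc, h a, ← mul_assoc, c.eq, mul_assoc, ih, ← mul_assoc, c'.eq]
  simpa using key Finset.univ

end Tensor

section Sign

variable {N : ℕ}

/-- Flip the bit at position `j`. -/
def bitFlip (j : Fin N) : (Fin N → Fin 2) ≃ (Fin N → Fin 2) := Equiv.addRight (Pi.single j 1)

lemma bitFlip_self (j : Fin N) (x : Fin N → Fin 2) : bitFlip j x j = x j + 1 := by
  simp [bitFlip]

lemma bitFlip_of_ne {j l : Fin N} (h : l ≠ j) (x : Fin N → Fin 2) : bitFlip j x l = x l := by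
  simp [bitFlip, h]

lemma wt_bitFlip (j : Fin N) (x : Fin N → Fin 2) :
    x j = 0 ∧ wt (bitFlip j x) = wt x + 1 ∨ x j = 1 ∧ wt x = wt (bitFlip j x) + 1 := by
  have e : ∀ y : Fin N → Fin 2, wt y = (y j : ℕ) + ∑ i ∈ {j}ᶜ, (y i : ℕ) := fun y =>
    Fintype.sum_eq_add_sum_compl j _
  have h : ∑ i ∈ {j}ᶜ, (bitFlip j x i : ℕ) = ∑ i ∈ {j}ᶜ, (x i : ℕ) :=
    Finset.sum_congr rfl fun i hi => by rw [bitFlip_of_ne (by simpa using hi)]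
  rw [e, e, h, bitFlip_self]
  generalize x j = a
  fin_cases a
  · left; simp; omega
  · right; simp; omega

/-- The Svetlichny sign of a string of weight `w`. -/
def weightSign (w : ℕ) : ℂ := (-1) ^ (w * (w + 1) / 2)

lemma weightSign_mul_self (w : ℕ) : weightSign w * weightSign w = 1 := by
  unfold weightSign
  rw [← mul_pow]; simp

lemma weightSign_add_two (w : ℕ) : weightSign (w + 2) = -weightSign w := by
  unfold weightSign
  have : (w + 2) * (w + 2 + 1) / 2 = w * (w + 1) / 2 + 2 * (w + 1) + 1 := by
    rw [show (w + 2) * (w + 2 + 1) = w * (w + 1) + 2 * (2 * (w + 1) + 1) by ring,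
      Nat.add_mul_div_left _ _ two_pos]
    ring
  rw [this, pow_succ, pow_add, pow_mul]
  simp

lemma sgn_mul_self (x : Fin N → Fin 2) : sgn x * sgn x = 1 := weightSign_mul_self _

lemma star_sgn (x : Fin N → Fin 2) : star (sgn x) = sgn x := by
  simp [sgn]

lemma sgn_mul_sgn_bitFlip_add {j l : Fin N} (hjl : j ≠ l) (x : Fin N → Fin 2) :
    sgn x * sgn (bitFlip j x) + sgn (bitFlip l x) * sgn (bitFlip j (bitFlip l x)) = 0 := by
  have e : ∀ y : Fin N → Fin 2, sgn y = weightSign (wt y) := fun _ => rfl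
  simp only [e]
  have h1 := wt_bitFlip j x
  have h2 := wt_bitFlip l x
  have h3 := wt_bitFlip j (bitFlip l x)
  rw [bitFlip_of_ne hjl] at h3
  rcases h1 with ⟨a1, h1⟩ | ⟨a1, h1⟩ <;> rcases h3 with ⟨a3, h3⟩ | ⟨a3, h3⟩
  · rcases h2 with ⟨-, h2⟩ | ⟨-, h2⟩
    · rw [h3, h2, h1, weightSign_add_two]; ring
    · rw [h3, h1, h2, weightSign_add_two]; ring
  · simp [a1] at a3
  · simp [a1] at a3
  · rcases h2 with ⟨-, h2⟩ | ⟨-, h2⟩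
    · have h4 : wt (bitFlip l x) = wt (bitFlip j x) + 2 := by omega
      have h5 : wt (bitFlip j (bitFlip l x)) = wt x := by omega
      rw [h4, h5, weightSign_add_two]; ring
    · have h4 : wt x = wt (bitFlip j (bitFlip l x)) + 2 := by omega
      have h5 : wt (bitFlip j x) = wt (bitFlip l x) := by omega
      rw [h4, h5, weightSign_add_two]; ring

lemma sum_sgn_mul_sgn_bitFlip {j l : Fin N} (hjl : j ≠ l) :
    ∑ x : Fin N → Fin 2, sgn x * sgn (bitFlip j x) = 0 := by
  have h : ∑ x : Fin N → Fin 2, sgn x * sgn (bitFlip j x) =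
      ∑ x : Fin N → Fin 2, sgn (bitFlip l x) * sgn (bitFlip j (bitFlip l x)) :=
    (Equiv.sum_comp (bitFlip l) fun x => sgn x * sgn (bitFlip j x)).symm
  have h2 : (∑ x : Fin N → Fin 2, sgn x * sgn (bitFlip j x)) +
      ∑ x : Fin N → Fin 2, sgn (bitFlip l x) * sgn (bitFlip j (bitFlip l x)) = 0 := by
    rw [← Finset.sum_add_distrib]
    exact Finset.sum_eq_zero fun x _ => sgn_mul_sgn_bitFlip_add hjl x
  rw [← h, ← two_mul] at h2
  simpa using h2

lemma sgn_zero : sgn (0 : Fin N → Fin 2) = 1 := by simp [sgn, wt]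

lemma sgn_bitFlip_zero (j : Fin N) : sgn (bitFlip j 0) = -1 := by
  have h : wt (bitFlip j 0) = 1 := by
    rcases wt_bitFlip j 0 with ⟨-, h⟩ | ⟨h, -⟩
    · simpa [wt] using h
    · simp at h
  simp [sgn, h]

lemma sgn_bitFlip_bitFlip_zero {j l : Fin N} (hjl : j ≠ l) : sgn (bitFlip j (bitFlip l 0)) = -1 := by
  have h := sgn_mul_sgn_bitFlip_add hjl 0
  simp only [sgn_zero, sgn_bitFlip_zero] at h
  linear_combination -h

end Sign

section Violation

lemma sq_smul_sub {R : Type*} [Ring R] [Algebra ℂ R] {G a b : R} {s t : ℂ} (hG : G * G = 1)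
    (ha : a * a = 1) (hb : b * b = 1) (hca : Commute G a) (hcb : Commute G b)
    (hs : s * s = 1) (ht : t * t = 1) :
    (rootTwo • G - (s • a + t • b)) * (rootTwo • G - (s • a + t • b)) =
      (4 : ℂ) • (1 : R) + (s * t) • (a * b + b * a) -
        (2 * rootTwo) • (s • (G * a) + t • (G * b)) := by
  simp only [sub_mul, mul_sub, add_mul, mul_add, smul_mul_assoc, mul_smul_comm, hG, ha, hb,
    ← hca.eq, ← hcb.eq]
  have hr := rootTwo_mul_self
  match_scalars
  · linear_combination hr + hs + ht
  all_goals ring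

variable {h s : ℕ} {d : Fin h → ℕ} {dD : ℕ}
  (A : (i : Fin h) → Fin 2 → Matrix (Fin (d i)) (Fin (d i)) ℂ)
  (M : (Fin (s + 1) → Fin 2) → Matrix (Fin dD) (Fin dD) ℂ)

/-- The observable measured jointly by all parties except the honest party `i`. -/
def restOp (i : Fin h) (x : Fin (h + (s + 1)) → Fin 2) :
    Matrix (FullIdx h d dD) (FullIdx h d dD) ℂ :=
  tens (Function.update (fun j => A j (x (Fin.castAdd (s + 1) j))) i 1)
    (M fun j => x (Fin.natAdd h j))

lemma bigOp_eq (i : Fin h) (x : Fin (h + (s + 1)) → Fin 2) :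
    bigOp A M x = restOp A M i x * factorHom i (A i (x (Fin.castAdd (s + 1) i))) :=
  (tens_update_one_mul_factorHom (fun j => A j (x (Fin.castAdd (s + 1) j))) _ i).symm

lemma restOp_bitFlip (i : Fin h) (x : Fin (h + (s + 1)) → Fin 2) :
    restOp A M i (bitFlip (Fin.castAdd (s + 1) i) x) = restOp A M i x := by
  unfold restOp
  congr 1
  · ext1 j
    by_cases hj : j = i
    · subst hj; simp
    · rw [Function.update_of_ne hj, Function.update_of_ne hj, bitFlip_of_ne]
      simpa using hj
  · congr 1
    ext1 j
    rw [bitFlip_of_ne]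
    intro e
    have := congrArg Fin.val e
    simp at this
    omega

lemma commute_restOp (i : Fin h) (x : Fin (h + (s + 1)) → Fin 2)
    (Y : Matrix (Fin (d i)) (Fin (d i)) ℂ) : Commute (restOp A M i x) (factorHom i Y) :=
  commute_tens_factorHom _ (by simp)

variable {A M}

lemma restOp_mul_restOp (hAsq : ∀ i b, A i b * A i b = 1) (i : Fin h)
    {x y : Fin (h + (s + 1)) → Fin 2}
    (hxy : ∀ j, x (Fin.castAdd (s + 1) j) = y (Fin.castAdd (s + 1) j)) :
    restOp A M i x * restOp A M i y =
      lastHom ((M fun j => x (Fin.natAdd h j)) * M fun j => y (Fin.natAdd h j)) := by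
  unfold restOp
  rw [tens_mul_tens, lastHom_apply]
  congr 1
  ext1 j
  by_cases hj : j = i
  · subst hj; simp
  · simp [Function.update_of_ne hj, hxy, hAsq]

lemma isHermitian_restOp (hAherm : ∀ i b, (A i b).IsHermitian) (hMherm : ∀ v, (M v).IsHermitian)
    (i : Fin h) (x : Fin (h + (s + 1)) → Fin 2) : (restOp A M i x)ᴴ = restOp A M i x := by
  unfold restOp
  rw [conjTranspose_tens, (hMherm _).eq]
  congr 1
  ext1 j
  by_cases hj : j = i
  · subst hj; simp
  · simp [Function.update_of_ne hj, (hAherm _ _).eq]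

lemma isHermitian_factorHom {ι : Type*} [Fintype ι] [DecidableEq ι] {n : ι → Type*}
    [∀ i, Fintype (n i)] [∀ i, DecidableEq (n i)] {m : Type*} [Fintype m] [DecidableEq m]
    {i : ι} {Y : Matrix (n i) (n i) ℂ} (hY : Y.IsHermitian) :
    (factorHom (m := m) i Y)ᴴ = factorHom i Y := by
  rw [factorHom_apply, conjTranspose_tens, conjTranspose_one]
  congr 1
  ext1 j
  by_cases hj : j = i
  · subst hj; simp [hY.eq]
  · simp [Function.update_of_ne hj]

open ComplexOrder in
/-- At the maximal violation, all parties but one act on the state as a combination of the two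
observables of the remaining honest party. -/
lemma restOp_mulVec (hAherm : ∀ i b, (A i b).IsHermitian) (hAsq : ∀ i b, A i b * A i b = 1)
    (hMherm : ∀ v, (M v).IsHermitian) (hMsq : ∀ v, M v * M v = 1)
    {ψ : FullIdx h d dD → ℂ} (hψ : star ψ ⬝ᵥ ψ = 1)
    (hmax : star ψ ⬝ᵥ (svetOp A M) *ᵥ ψ = 2 ^ (h + s) * rootTwo)
    (i : Fin h) (x : Fin (h + (s + 1)) → Fin 2) :
    (rootTwo • restOp A M i x - (sgn x • factorHom i (A i (x (Fin.castAdd (s + 1) i))) +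
      sgn (bitFlip (Fin.castAdd (s + 1) i) x) •
        factorHom i (A i (x (Fin.castAdd (s + 1) i) + 1)))) *ᵥ ψ = 0 := by
  set j := Fin.castAdd (s + 1) i with hj
  let a : Fin 2 → Matrix (FullIdx h d dD) (FullIdx h d dD) ℂ := fun b => factorHom i (A i b)
  have ha : ∀ b, a b * a b = 1 := fun b => by simp only [a, ← map_mul, hAsq, map_one]
  have hG : ∀ x, restOp A M i x * restOp A M i x = 1 := fun x => by
    rw [restOp_mul_restOp hAsq i fun _ => rfl, hMsq, map_one]
  let K : (Fin (h + (s + 1)) → Fin 2) → Matrix (FullIdx h d dD) (FullIdx h d dD) ℂ := fun x =>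
    rootTwo • restOp A M i x - (sgn x • a (x j) + sgn (bitFlip j x) • a (x j + 1))
  have hK : ∀ x, (K x)ᴴ = K x := fun x => by
    have e : ∀ b, (a b)ᴴ = a b := fun b => isHermitian_factorHom (hAherm i b)
    simp only [K, conjTranspose_sub, conjTranspose_add, conjTranspose_smul, star_sgn,
      star_rootTwo, isHermitian_restOp hAherm hMherm, e]
  have hanti : ∀ b, a b * a (b + 1) + a (b + 1) * a b = a 0 * a 1 + a 1 * a 0 := by
    intro b
    fin_cases b
    · simp
    · simp [add_comm]
  have hsq : ∀ x, K x * K x = (4 : ℂ) • 1 + (sgn x * sgn (bitFlip j x)) •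
      (a 0 * a 1 + a 1 * a 0) - (2 * rootTwo) • (sgn x • bigOp A M x +
        sgn (bitFlip j x) • bigOp A M (bitFlip j x)) := fun x => by
    rw [sq_smul_sub (hG x) (ha _) (ha _) (commute_restOp A M i x _) (commute_restOp A M i x _)
      (sgn_mul_self _) (sgn_mul_self _), hanti, bigOp_eq A M i x, bigOp_eq A M i (bitFlip j x),
      hj, restOp_bitFlip, bitFlip_self]
  have hne : j ≠ Fin.natAdd h (0 : Fin (s + 1)) := fun e => by
    have := congrArg Fin.val e
    simp [hj] at this
    omega
  have hsum : ∑ x, K x * K x = ((4 : ℂ) * 2 ^ (h + (s + 1))) • 1 -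
      (4 * rootTwo) • svetOp A M := by
    have e : ∑ x, sgn (bitFlip j x) • bigOp A M (bitFlip j x) = svetOp A M :=
      Equiv.sum_comp (bitFlip j) fun x => sgn x • bigOp A M x
    have e' : ∑ x, sgn x • bigOp A M x = svetOp A M := rfl
    simp only [hsq, Finset.sum_sub_distrib, Finset.sum_add_distrib, ← Finset.sum_smul,
      ← Finset.smul_sum, sum_sgn_mul_sgn_bitFlip hne, e, e', Finset.sum_const,
      Finset.card_univ, Fintype.card_fun, Fintype.card_fin]
    simp only [← Nat.cast_smul_eq_nsmul ℂ]
    push_cast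
    module
  have hquad : ∑ x, star (K x *ᵥ ψ) ⬝ᵥ (K x *ᵥ ψ) = 0 := by
    have e : ∀ x, star (K x *ᵥ ψ) ⬝ᵥ (K x *ᵥ ψ) = star ψ ⬝ᵥ ((K x * K x) *ᵥ ψ) := fun x => by
      rw [star_mulVec, hK, ← dotProduct_mulVec, mulVec_mulVec]
    simp only [e]
    rw [← dotProduct_sum, ← sum_mulVec, hsum, sub_mulVec, smul_mulVec, smul_mulVec, one_mulVec,
      dotProduct_sub, dotProduct_smul, dotProduct_smul, hψ, hmax, smul_eq_mul, smul_eq_mul]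
    have hr := rootTwo_mul_self
    linear_combination (-4 * 2 ^ (h + s)) * hr
  have hz := (Finset.sum_eq_zero_iff_of_nonneg fun x _ =>
    dotProduct_star_self_nonneg (K x *ᵥ ψ)).mp hquad x (Finset.mem_univ _)
  exact dotProduct_star_self_eq_zero.mp hz

/-- The input string of the dishonest parties with a single one, at position `0`. -/
def oneInput (h s : ℕ) : Fin (h + (s + 1)) → Fin 2 := bitFlip (Fin.natAdd h 0) 0

/-- A vector, repeated in every column of a square matrix. -/
def repeatCol {m : Type*} (ψ : m → ℂ) : Matrix m m ℂ := Matrix.of fun p _ => ψ p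

lemma mul_repeatCol {m : Type*} [Fintype m] (L : Matrix m m ℂ) (ψ : m → ℂ) :
    L * repeatCol ψ = repeatCol (L *ᵥ ψ) := rfl

lemma repeatCol_injective {m : Type*} : Function.Injective (repeatCol (m := m)) := fun ψ φ e => by
  ext p
  exact congrFun (congrFun e p) p

/-- The relations satisfied at the maximal violation by the observables of an honest party and two
of the dishonest observables. -/
lemma selfTest_relations (hAherm : ∀ i b, (A i b).IsHermitian) (hAsq : ∀ i b, A i b * A i b = 1)
    (hMherm : ∀ v, (M v).IsHermitian) (hMsq : ∀ v, M v * M v = 1)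
    {ψ : FullIdx h d dD → ℂ} (hψ : star ψ ⬝ᵥ ψ = 1)
    (hmax : star ψ ⬝ᵥ (svetOp A M) *ᵥ ψ = 2 ^ (h + s) * rootTwo) (i : Fin h)
    {A₀ A₁ D₀ D₁ Ψ : Matrix (FullIdx h d dD) (FullIdx h d dD) ℂ}
    (hA₀ : A₀ = factorHom i (A i 0)) (hA₁ : A₁ = factorHom i (A i 1))
    (hD₀ : D₀ = lastHom (M 0)) (hD₁ : D₁ = lastHom (M fun j => oneInput h s (Fin.natAdd h j)))
    (hΨ : Ψ = repeatCol ψ) :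
    A₀ * (A₁ * Ψ) = -(A₁ * (A₀ * Ψ)) ∧ D₀ * (D₁ * Ψ) = -(D₁ * (D₀ * Ψ)) ∧
      D₁ * (D₀ * Ψ) = A₁ * (A₀ * Ψ) ∧
        rootTwo • (tens (fun j => A j 0) 1 * Ψ) = (D₀ - D₁) * Ψ := by
  have hne : Fin.castAdd (s + 1) i ≠ Fin.natAdd h (0 : Fin (s + 1)) := fun e => by
    have := congrArg Fin.val e
    simp at this
    omega
  have hcast : ∀ j : Fin h, oneInput h s (Fin.castAdd (s + 1) j) = 0 := fun j => by
    rw [oneInput, bitFlip_of_ne, Pi.zero_apply]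
    intro e
    have := congrArg Fin.val e
    simp at this
    omega
  set G₀ := restOp A M i 0 with hG₀
  set G₁ := restOp A M i (oneInput h s) with hG₁
  have sA₀ : A₀ * A₀ = 1 := by rw [hA₀, ← map_mul, hAsq, map_one]
  have sA₁ : A₁ * A₁ = 1 := by rw [hA₁, ← map_mul, hAsq, map_one]
  have c₀₀ : G₀ * A₀ = A₀ * G₀ := hA₀ ▸ (commute_restOp A M i 0 _).eq
  have c₀₁ : G₀ * A₁ = A₁ * G₀ := hA₁ ▸ (commute_restOp A M i 0 _).eq
  have c₁₀ : G₁ * A₀ = A₀ * G₁ := hA₀ ▸ (commute_restOp A M i _ _).eq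
  have c₁₁ : G₁ * A₁ = A₁ * G₁ := hA₁ ▸ (commute_restOp A M i _ _).eq
  have sG₀ : G₀ * G₀ = 1 := by
    rw [hG₀, restOp_mul_restOp hAsq i fun _ => rfl, hMsq, map_one]
  have g₁₀ : G₁ * G₀ = D₁ * D₀ := by
    rw [hG₀, hG₁, restOp_mul_restOp hAsq i fun j => hcast j, map_mul, hD₀, hD₁]; rfl
  have g₀₁ : G₀ * G₁ = D₀ * D₁ := by
    rw [hG₀, hG₁, restOp_mul_restOp hAsq i fun j => (hcast j).symm, map_mul, hD₀, hD₁]; rfl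
  have r₀ : rootTwo • (G₀ * Ψ) = (A₀ - A₁) * Ψ := by
    have := restOp_mulVec hAherm hAsq hMherm hMsq hψ hmax i 0
    rw [sgn_zero, sgn_bitFlip_zero, Pi.zero_apply, zero_add, ← hA₀, ← hA₁, ← hG₀] at this
    have e := congrArg repeatCol this
    rw [← mul_repeatCol, ← hΨ, sub_mul, smul_mul_assoc] at e
    rw [sub_eq_zero.mp (e.trans rfl)]
    simp [sub_eq_add_neg]
  have r₁ : rootTwo • (G₁ * Ψ) = -((A₀ + A₁) * Ψ) := by
    have := restOp_mulVec hAherm hAsq hMherm hMsq hψ hmax i (oneInput h s)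
    rw [hcast, oneInput, sgn_bitFlip_zero, sgn_bitFlip_bitFlip_zero hne, ← oneInput, zero_add,
      ← hA₀, ← hA₁, ← hG₁] at this
    have e := congrArg repeatCol this
    rw [← mul_repeatCol, ← hΨ, sub_mul, smul_mul_assoc] at e
    rw [sub_eq_zero.mp (e.trans rfl)]
    simp [add_mul, add_comm]
  have hac := anticommute_of_mul_eq sA₀ sA₁ sG₀ c₀₀ c₀₁ r₀
  have hDA := mul_eq_of_mul_eq sA₀ sA₁ c₁₀ c₁₁ hac r₀ r₁
  have hDA' := mul_eq_neg_of_mul_eq sA₀ sA₁ c₀₀ c₀₁ hac r₀ r₁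
  rw [← mul_assoc, g₁₀, mul_assoc] at hDA
  rw [← mul_assoc, g₀₁, mul_assoc] at hDA'
  refine ⟨hac, by rw [hDA', hDA], hDA, ?_⟩
  set Q : Matrix (FullIdx h d dD) (FullIdx h d dD) ℂ :=
    tens (Function.update (fun j => A j 0) i 1) 1 with hQ
  have q : ∀ x : Fin (h + (s + 1)) → Fin 2, (∀ j : Fin h, x (Fin.castAdd (s + 1) j) = 0) →
      Q * restOp A M i x = lastHom (M fun j => x (Fin.natAdd h j)) := fun x hx => by
    rw [hQ, restOp, tens_mul_tens, lastHom_apply, one_mul]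
    congr 1
    ext1 j
    by_cases hj : j = i
    · subst hj; simp
    · simp [Function.update_of_ne hj, hx, hAsq]
  have q₀ : Q * G₀ = D₀ := by rw [hG₀, q 0 fun _ => rfl, hD₀]; rfl
  have q₁ : Q * G₁ = D₁ := by rw [hG₁, q _ hcast, hD₁]
  have qA : Q * A₀ = tens (fun j => A j 0) 1 := by
    rw [hQ, hA₀]; exact tens_update_one_mul_factorHom (fun j => A j 0) 1 i
  have e : rootTwo • ((D₀ - D₁) * Ψ) = (2 : ℂ) • (tens (fun j => A j 0) 1 * Ψ) := by
    calc rootTwo • ((D₀ - D₁) * Ψ) = Q * (rootTwo • (G₀ * Ψ) - rootTwo • (G₁ * Ψ)) := by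
          rw [← q₀, ← q₁, ← smul_sub, mul_smul_comm, ← sub_mul, ← mul_assoc, mul_sub]
      _ = Q * ((2 : ℂ) • (A₀ * Ψ)) := by
          rw [r₀, r₁]; congr 1; simp only [sub_mul, add_mul]; module
      _ = _ := by rw [mul_smul_comm, ← mul_assoc, qA]
  apply smul_right_injective _ rootTwo_ne_zero
  simp only [smul_smul, rootTwo_mul_self]
  rw [e]

end Violation

lemma sum_swapBlock {n : Type*} [Fintype n] [DecidableEq n] {X Y : Matrix n n ℂ}
    (hX : X.IsHermitian) (hY : Y.IsHermitian) (hXX : X * X = 1) (hYY : Y * Y = 1) {τ : ℂ}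
    (hτ : star τ * τ = 1) :
    ∑ b, (swapBlock X Y τ b)ᴴ * swapBlock X Y τ b = 1 := by
  have e : ∀ Z, Y * (Y * Z) = Z := fun Z => by rw [← mul_assoc, hYY, one_mul]
  have hr := rootTwo_mul_self
  have hI := Complex.I_mul_I
  simp only [Fin.sum_univ_two, swapBlock, if_true, Fin.isValue, one_ne_zero, if_false,
    conjTranspose_smul, conjTranspose_sub, conjTranspose_add, conjTranspose_mul, hX.eq, hY.eq,
    conjTranspose_one, star_mul', star_div₀, star_rootTwo, Complex.star_def, Complex.conj_I]
  simp only [smul_mul_assoc, mul_smul_comm, sub_mul, mul_sub, add_mul, mul_add, mul_one, one_mul,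
    mul_assoc, e, hXX, hYY]
  rw [Complex.star_def] at hτ
  simp only [map_ofNat]
  match_scalars
  all_goals try ring1
  · linear_combination (rootTwo ^ 2 * (1 - Complex.I ^ 2) / 8) * hτ - (rootTwo ^ 2 / 4) * hI +
      (1 / 2) * hr
  · linear_combination (rootTwo ^ 2 * (1 + (starRingEnd ℂ) τ * τ) / 8) * hI
  · linear_combination (rootTwo ^ 2 * Complex.I / 8) * hτ
  · linear_combination (-rootTwo ^ 2 * Complex.I / 8) * hτ

lemma star_ghzPhase_mul : star ghzPhase * ghzPhase = 1 := by
  have hr := rootTwo_mul_self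
  have hI := Complex.I_mul_I
  have h2 : star (2 : ℂ) = 2 := star_ofNat 2
  simp only [ghzPhase, star_mul', star_add, star_one, star_div₀, star_rootTwo, h2,
    Complex.star_def, Complex.conj_I]
  linear_combination (1 / 2) * hr - (rootTwo * rootTwo / 4) * hI

section Extraction

variable {h s : ℕ} {d : Fin h → ℕ} {dD : ℕ}
  {A : (i : Fin h) → Fin 2 → Matrix (Fin (d i)) (Fin (d i)) ℂ}
  {D₀ D₁ : Matrix (Fin dD) (Fin dD) ℂ} {Ψ : Matrix (FullIdx h d dD) (FullIdx h d dD) ℂ}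

lemma tens_swapBlock_of_ne (hAsq : ∀ i b, A i b * A i b = 1) (hDsq : D₀ * D₀ = 1)
    (hA : ∀ i, factorHom i (A i 0) * (factorHom i (A i 1) * Ψ) =
      -(factorHom i (A i 1) * (factorHom i (A i 0) * Ψ)))
    (hD : lastHom D₀ * (lastHom D₁ * Ψ) = -(lastHom D₁ * (lastHom D₀ * Ψ)))
    (hDA : ∀ i, lastHom D₁ * (lastHom D₀ * Ψ) =
      factorHom i (A i 1) * (factorHom i (A i 0) * Ψ))
    (σ τ : ℂ) {i : Fin h} {b c : Fin 2} (hbc : b ≠ c) :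
    factorHom i (swapBlock (A i 0) (A i 1) σ b) * (lastHom (swapBlock D₀ D₁ τ c) * Ψ) = 0 := by
  rw [map_swapBlock, map_swapBlock]
  exact swapBlock_mul_swapBlock_eq_zero σ τ (by rw [← map_mul, hAsq, map_one])
    (by rw [← map_mul, hAsq, map_one]) (by rw [← map_mul, hDsq, map_one])
    (commute_lastHom_factorHom _ _ _) (commute_lastHom_factorHom _ _ _)
    (commute_lastHom_factorHom _ _ _) (commute_lastHom_factorHom _ _ _) (hA i) hD (hDA i) hbc

/-- After extraction, only the branches in which all parties agree survive. -/
lemma tens_mul_eq_zero {L : (i : Fin h) → Fin 2 → Matrix (Fin (d i)) (Fin (d i)) ℂ}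
    {W : Fin 2 → Matrix (Fin dD) (Fin dD) ℂ}
    (hoff : ∀ i b c, b ≠ c → factorHom i (L i b) * (lastHom (W c) * Ψ) = 0)
    {b : Fin h → Fin 2} {c : Fin 2} (hbc : b ≠ fun _ => c) :
    tens (fun i => L i (b i)) (W c) * Ψ = 0 := by
  obtain ⟨i, hi⟩ := Function.ne_iff.mp hbc
  rw [tens_eq_mul_lastHom, ← tens_update_one_mul_factorHom (fun i => L i (b i)) 1 i, mul_assoc,
    mul_assoc, hoff i _ _ hi, mul_zero]

/-- After extraction, the two surviving branches coincide. -/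
lemma tens_swapBlock_eq (hAsq : ∀ i b, A i b * A i b = 1) (hDsq : D₀ * D₀ = 1)
    (hD : lastHom D₀ * (lastHom D₁ * Ψ) = -(lastHom D₁ * (lastHom D₀ * Ψ)))
    (hT : rootTwo • (tens (fun j => A j 0) 1 * Ψ) = (lastHom D₀ - lastHom D₁) * Ψ)
    (hoff : ∀ i b c, b ≠ c → factorHom i (swapBlock (A i 0) (A i 1) 1 b) *
      (lastHom (swapBlock D₀ D₁ ghzPhase c) * Ψ) = 0) :
    tens (fun i => swapBlock (A i 0) (A i 1) 1 1) (swapBlock D₀ D₁ ghzPhase 1) * Ψ =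
      tens (fun i => swapBlock (A i 0) (A i 1) 1 0) (swapBlock D₀ D₁ ghzPhase 0) * Ψ := by
  set P : Matrix (FullIdx h d dD) (FullIdx h d dD) ℂ :=
    tens (fun i => (rootTwo / 2) • (1 + A i 0)) 1 with hP
  have hc : ∀ X, Commute P (lastHom X) := fun X => commute_tens_lastHom _ X
  have hmain : ∀ c : Fin 2,
      tens (fun i => swapBlock (A i 0) (A i 1) 1 c) (swapBlock D₀ D₁ ghzPhase c) * Ψ =
        lastHom (swapBlock D₀ D₁ ghzPhase c) * (P * Ψ) := by
    intro c
    rw [tens_eq_mul_lastHom, ← mul_assoc _ P, ← (hc _).eq, mul_assoc, mul_assoc]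
    refine tens_mul_congr fun i => ?_
    have h0 := hoff i (c + 1) c (by fin_cases c <;> simp)
    have h1 : (rootTwo / 2) • (1 + A i 0) =
        swapBlock (A i 0) (A i 1) 1 c + swapBlock (A i 0) (A i 1) 1 (c + 1) := by
      rw [← swapBlock_add (A i 0) (A i 1)]
      fin_cases c
      · rfl
      · exact add_comm _ _
    rw [h1, map_add, add_mul, h0, add_zero]
  have hPA : P * tens (fun j => A j 0) 1 = P := by
    rw [hP, tens_mul_tens, mul_one]
    congr 1
    ext1 i
    rw [smul_mul_assoc, add_mul, hAsq, one_mul, add_comm]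
  rw [hmain, hmain, map_swapBlock, map_swapBlock]
  refine swapBlock_ghzPhase (by rw [← map_mul, hDsq, map_one]) ?_ ?_
  · have := congrArg (P * ·) hD
    simp only [mul_neg, ← mul_assoc, (hc _).eq] at this
    simp only [mul_assoc, (hc _).eq] at this ⊢
    simpa only [← mul_assoc, (hc _).eq] using this
  · rw [← mul_assoc, sub_mul, ← (hc _).eq, ← (hc _).eq, ← mul_sub, mul_assoc, ← hT,
      mul_smul_comm, ← mul_assoc, hPA]

/-- Local isometries preserve the norm of the state. -/
lemma sum_star_dotProduct_tens {ι β : Type*} [Fintype ι] [DecidableEq ι] [Fintype β]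
    [DecidableEq β] {n : ι → Type*} [∀ i, Fintype (n i)] [∀ i, DecidableEq (n i)] {m : Type*}
    [Fintype m] [DecidableEq m] {L : ∀ i, β → Matrix (n i) (n i) ℂ} {W : β → Matrix m m ℂ}
    (hL : ∀ i, ∑ b, (L i b)ᴴ * L i b = 1) (hW : ∑ c, (W c)ᴴ * W c = 1)
    (ψ : ((∀ i, n i) × m) → ℂ) :
    ∑ b : ι → β, ∑ c, star (tens (fun i => L i (b i)) (W c) *ᵥ ψ) ⬝ᵥ
      (tens (fun i => L i (b i)) (W c) *ᵥ ψ) = star ψ ⬝ᵥ ψ := by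
  have e : ∀ (b : ι → β) c, star (tens (fun i => L i (b i)) (W c) *ᵥ ψ) ⬝ᵥ
      (tens (fun i => L i (b i)) (W c) *ᵥ ψ) =
        star ψ ⬝ᵥ (tens (fun i => (L i (b i))ᴴ * L i (b i)) ((W c)ᴴ * W c) *ᵥ ψ) := fun b c => by
    rw [star_mulVec, ← dotProduct_mulVec, mulVec_mulVec, conjTranspose_tens, tens_mul_tens]
  simp only [e, ← dotProduct_sum, ← sum_mulVec]
  rw [sum_tens (fun i b => (L i b)ᴴ * L i b) fun c => (W c)ᴴ * W c]
  simp only [hL, hW, tens_one, one_mulVec]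

lemma isometry_of_sum {n : Type*} [Fintype n] [DecidableEq n] {L : Fin 2 → Matrix n n ℂ}
    (hL : ∑ b, (L b)ᴴ * L b = 1) :
    (Matrix.of fun (p : Fin 2 × n) q => L p.1 p.2 q)ᴴ *
      (Matrix.of fun (p : Fin 2 × n) q => L p.1 p.2 q) = 1 := by
  rw [← hL]
  ext q r
  simp only [mul_apply, conjTranspose_apply, of_apply, Fintype.sum_prod_type, Matrix.sum_apply]

/-- The isometry that copies the extracted qubit to all qubits indexed by `α`. -/
def copyIsometry (α : Type*) [Fintype α] {n : Type*} (W : Fin 2 → Matrix n n ℂ) :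
    Matrix ((α → Fin 2) × n) n ℂ :=
  Matrix.of fun p q => (if p.1 = fun _ => 0 then W 0 p.2 q else 0) +
    (if p.1 = fun _ => 1 then W 1 p.2 q else 0)

lemma const_zero_ne_const_one {α : Type*} [Nonempty α] :
    (fun _ : α => (0 : Fin 2)) ≠ fun _ => 1 := fun e => by
  simpa using congrFun e (Classical.arbitrary α)

lemma copyIsometry_const {α : Type*} [Fintype α] [Nonempty α] {n : Type*}
    (W : Fin 2 → Matrix n n ℂ) (c : Fin 2) (a q : n) :
    copyIsometry α W (fun _ => c, a) q = W c a q := by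
  fin_cases c
  · simp [copyIsometry, const_zero_ne_const_one]
  · simp [copyIsometry, const_zero_ne_const_one.symm]

lemma copyIsometry_conjTranspose_mul_self {α : Type*} [Fintype α] [DecidableEq α] [Nonempty α]
    {n : Type*} [Fintype n] [DecidableEq n] {W : Fin 2 → Matrix n n ℂ}
    (hW : ∑ c, (W c)ᴴ * W c = 1) : (copyIsometry α W)ᴴ * copyIsometry α W = 1 := by
  rw [← hW]
  ext q r
  simp only [mul_apply, conjTranspose_apply, Fintype.sum_prod_type, Fin.sum_univ_two,
    Matrix.add_apply]
  have e : ∀ g : α → Fin 2, ∑ a, star (copyIsometry α W (g, a) q) * copyIsometry α W (g, a) r =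
      (if g = fun _ => 0 then ∑ a, star (W 0 a q) * W 0 a r else 0) +
        (if g = fun _ => 1 then ∑ a, star (W 1 a q) * W 1 a r else 0) := by
    intro g
    by_cases h0 : g = fun _ => 0
    · subst h0
      simp [copyIsometry_const, const_zero_ne_const_one]
    · by_cases h1 : g = fun _ => 1
      · subst h1
        simp [copyIsometry_const, const_zero_ne_const_one.symm]
      · simp [copyIsometry, h0, h1]
  simp only [e, Finset.sum_add_distrib, Finset.sum_ite_eq', Finset.mem_univ, if_true]

lemma append_eq_const {h k : ℕ} (b : Fin h → Fin 2) (g : Fin k → Fin 2) (c : Fin 2) :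
    (Fin.append b g = fun _ => c) ↔ (b = fun _ => c) ∧ g = fun _ => c := by
  constructor
  · intro e
    refine ⟨funext fun i => ?_, funext fun i => ?_⟩
    · simpa using congrFun e (Fin.castAdd k i)
    · simpa using congrFun e (Fin.natAdd h i)
  · rintro ⟨rfl, rfl⟩
    ext i
    refine Fin.addCases (fun i => ?_) (fun i => ?_) i <;> simp

lemma star_dotProduct_self_eq {m : Type*} [Fintype m] (v : m → ℂ) :
    star v ⬝ᵥ v = ((∑ p, ‖v p‖ ^ 2 : ℝ) : ℂ) := by
  simp [dotProduct, Complex.conj_mul']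

end Extraction

/-- Theorem 3 (device-independent certification of the `N`-partite GHZ state with dishonest
parties): with `h = k - 1 ≥ 1` honest parties and dishonest input strings of length
`N - k + 1 = s + 1` (so `N = h + (s+1)` and `2 ≤ k ≤ N`), any unit state maximally violating
`Ŝ_N^+` is mapped, by local isometries on the honest parties and a global isometry
`V_D : ℂ^{d_D} → (ℂ²)^{⊗(N-k+1)} ⊗ ℂ^{m_D}` on the dishonest group, to the `N`-partite GHZ
state tensored with uncorrelated degrees of freedom. -/
theorem stmt_18 (h s : ℕ) (hh : 1 ≤ h) (d : Fin h → ℕ) (dD : ℕ)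
    (A : (i : Fin h) → Fin 2 → Matrix (Fin (d i)) (Fin (d i)) ℂ)
    (M : (Fin (s + 1) → Fin 2) → Matrix (Fin dD) (Fin dD) ℂ)
    (hAherm : ∀ i b, (A i b).IsHermitian) (hAsq : ∀ i b, A i b * A i b = 1)
    (hMherm : ∀ v, (M v).IsHermitian) (hMsq : ∀ v, M v * M v = 1)
    (ψ : FullIdx h d dD → ℂ) (hψ : (∑ p, ‖ψ p‖ ^ 2) = 1)
    (hmax : ∑ p, (starRingEnd ℂ) (ψ p) * (svetOp A M).mulVec ψ p =
      ((2 ^ (h + s) * Real.sqrt 2 : ℝ) : ℂ)) :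
    ∃ (m : Fin h → ℕ) (mD : ℕ)
      (V : (i : Fin h) → Matrix (Fin 2 × Fin (m i)) (Fin (d i)) ℂ)
      (VD : Matrix ((Fin (s + 1) → Fin 2) × Fin mD) (Fin dD) ℂ)
      (ζ : (((i : Fin h) → Fin (m i)) × Fin mD) → ℂ),
      (∀ i, (V i)ᴴ * V i = 1) ∧ VDᴴ * VD = 1 ∧ (∑ a, ‖ζ a‖ ^ 2) = 1 ∧
        ∀ (f : (i : Fin h) → Fin 2 × Fin (m i)) (g : Fin (s + 1) → Fin 2) (a : Fin mD),
          (∑ x : FullIdx h d dD,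
              (∏ i, V i (f i) (x.1 i)) * VD (g, a) x.2 * ψ x) =
            ghzVec (Fin.append (fun i => (f i).1) g) * ζ (fun i => (f i).2, a) := by
  have hψ' : star ψ ⬝ᵥ ψ = 1 := by rw [star_dotProduct_self_eq, hψ, Complex.ofReal_one]
  have hmax' : star ψ ⬝ᵥ (svetOp A M) *ᵥ ψ = 2 ^ (h + s) * rootTwo := by
    refine hmax.trans ?_
    simp [rootTwo]
  have rel := fun i => selfTest_relations hAherm hAsq hMherm hMsq hψ' hmax' i rfl rfl rfl rfl rfl
  set D₀ := M 0
  set D₁ := M fun j => oneInput h s (Fin.natAdd h j)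
  have i₀ : Fin h := ⟨0, hh⟩
  let L : (i : Fin h) → Fin 2 → Matrix (Fin (d i)) (Fin (d i)) ℂ :=
    fun i b => swapBlock (A i 0) (A i 1) 1 b
  let W : Fin 2 → Matrix (Fin dD) (Fin dD) ℂ := fun c => swapBlock D₀ D₁ ghzPhase c
  have hoff : ∀ i b c, b ≠ c →
      factorHom i (L i b) * (lastHom (W c) * repeatCol ψ) = 0 := fun i b c hbc =>
    tens_swapBlock_of_ne hAsq (hMsq _) (fun i => (rel i).1) (rel i).2.1 (fun i => (rel i).2.2.1)
      1 ghzPhase hbc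
  have hL : ∀ i, ∑ b, (L i b)ᴴ * L i b = 1 := fun i =>
    sum_swapBlock (hAherm i 0) (hAherm i 1) (hAsq i 0) (hAsq i 1) (by simp)
  have hW : ∑ c, (W c)ᴴ * W c = 1 :=
    sum_swapBlock (hMherm _) (hMherm _) (hMsq _) (hMsq _) star_ghzPhase_mul
  set t : FullIdx h d dD → ℂ := tens (fun i => L i 0) (W 0) *ᵥ ψ with ht
  have hbranch : ∀ (b : Fin h → Fin 2) (c : Fin 2),
      tens (fun i => L i (b i)) (W c) *ᵥ ψ = if b = fun _ => c then t else 0 := by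
    intro b c
    apply repeatCol_injective
    rw [← mul_repeatCol]
    split_ifs with hbc
    · subst hbc
      rw [ht, ← mul_repeatCol]
      fin_cases c
      · rfl
      · exact tens_swapBlock_eq hAsq (hMsq _) (rel i₀).2.1 (rel i₀).2.2.2 hoff
    · rw [tens_mul_eq_zero hoff hbc]; rfl
  have hnorm : (2 : ℂ) * (star t ⬝ᵥ t) = 1 := by
    rw [← hψ', ← sum_star_dotProduct_tens hL hW ψ, Finset.sum_comm]
    have e : ∀ (b : Fin h → Fin 2) (c : Fin 2),
        star (if b = fun _ => c then t else 0) ⬝ᵥ (if b = fun _ => c then t else 0) =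
          if b = fun _ => c then star t ⬝ᵥ t else 0 := fun b c => by split_ifs <;> simp
    simp only [hbranch, e, Finset.sum_ite_eq', Finset.mem_univ, if_true, Fin.sum_univ_two]
    ring
  refine ⟨d, dD, fun i => Matrix.of fun p q => L i p.1 p.2 q, copyIsometry (Fin (s + 1)) W,
    fun a => rootTwo * t a, fun i => isometry_of_sum (hL i),
    copyIsometry_conjTranspose_mul_self hW, ?_, fun f g a => ?_⟩
  · rw [star_dotProduct_self_eq] at hnorm
    have hr : ‖rootTwo‖ ^ 2 = 2 := by
      rw [← norm_pow, pow_two, rootTwo_mul_self]; simp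
    simp only [norm_mul, mul_pow, ← Finset.mul_sum, hr]
    exact_mod_cast hnorm
  · have hconst : ∀ c : Fin 2, ∑ x : FullIdx h d dD, (∏ i, L i (f i).1 (f i).2 (x.1 i)) *
        W c a x.2 * ψ x = if (fun i => (f i).1) = fun _ => c then t (fun i => (f i).2, a) else 0 := by
      intro c
      have := congrFun (hbranch (fun i => (f i).1) c) (fun i => (f i).2, a)
      refine Eq.trans rfl (this.trans ?_)
      split_ifs <;> rfl
    have hsqrt : ∀ z : ℂ, (1 / (Real.sqrt 2 : ℂ)) * (rootTwo * z) = z := fun z => by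
      have : (Real.sqrt 2 : ℂ) ≠ 0 := rootTwo_ne_zero
      rw [← mul_assoc, rootTwo, one_div, inv_mul_cancel₀ this, one_mul]
    simp only [ghzVec, append_eq_const, of_apply]
    by_cases h0 : g = fun _ => 0
    · subst h0
      simp only [copyIsometry_const, hconst, const_zero_ne_const_one, and_true, and_false,
        if_false, add_zero]
      split_ifs
      · rw [hsqrt]
      · simp
    · by_cases h1 : g = fun _ => 1
      · subst h1
        simp only [copyIsometry_const, hconst, const_zero_ne_const_one.symm, and_true, and_false,
          if_false, zero_add]
        split_ifs
        · rw [hsqrt]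
        · simp
      · simp [copyIsometry, h0, h1]
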